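/- Observational equivalence of the interleaved and serialized executions (abstract form of the paper's Lemma 6.2 together with Theorem 6.4): let Σ be a type and let there be k threads, where thread h (for h = 1, …, k, ordered by linearization points) has n_h steps with step functions f_{h,i} : Σ → Σ, guards g_{h,i} : Σ → Prop, and a basis chain B_{h,0}, …, B_{h,n_h} of sets of predicates on Σ satisfying, for each i < n_h: g_{h,i} and its pointwise negation are positive boolean combinations over B_{h,i}, and φ ∘ f_{h,i} is a positive boolean combination over B_{h,i} for every φ ∈ B_{h,i+1}. Suppose each thread h has interleaved views τ_{h,0}, …, τ_{h,n_h} with g_{h,i} τ_{h,i} and TS_{B_{h,i+1}}(f_{h,i} τ_{h,i}) ⊆ TS_{B_{h,i+1}}(τ_{h,i+1}) for all i < n_h (interference-freedom), that the quiescent basis is shared across thread boundaries, B_{h,n_h} = B_{h+1,0} for h < k, and that TS_{B_{h+1,0}}(τ_{h,n_h}) ⊆ TS_{B_{h+1,0}}(τ_{h+1,0}) for h < k (no thread changes the quiescent basis predicates between the last step of thread h and the first step of thread h+1). Define the serial execution by ρ_{1,0} := σ₀ where TS_{B_{1,0}}(σ₀) ⊆ TS_{B_{1,0}}(τ_{1,0}),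 ρ_{h,i+1} := f_{h,i} ρ_{h,i}, and ρ_{h+1,0} := ρ_{h,n_h}. Then every guard holds along the serial execution (g_{h,i} ρ_{h,i} for all h, i), so the serialized schedule is feasible, and TS_{B_{h,i}}(ρ_{h,i}) ⊆ TS_{B_{h,i}}(τ_{h,i}) for all h and i ≤ n_h; consequently, if for each thread h a return function ret_h : Σ → α_h satisfies that (fun σ => ret_h σ = c) is a positive boolean combination over B_{h,n_h} for every c, then ret_h ρ_{h,n_h} = ret_h τ_{h,n_h} for every h: every thread returns the same value in the interleaved execution as in the serial execution. -/

import Mathlib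

/-- A positive boolean combination over a set `S` of predicates on `St`:
built from members of `S` by finitely many pointwise conjunctions and disjunctions. -/
inductive PosComb {St : Type*} (S : Set (St → Prop)) : (St → Prop) → Prop
  | base {p : St → Prop} : p ∈ S → PosComb S p
  | and {p q : St → Prop} : PosComb S p → PosComb S q → PosComb S (fun σ => p σ ∧ q σ)
  | or {p q : St → Prop} : PosComb S p → PosComb S q → PosComb S (fun σ => p σ ∨ q σ)

/-- The set of predicates in `S` that hold at state `σ`. -/
def TS {St : Type*} (S : Set (St → Prop)) (σ : St) : Set (St → Prop) :=
  {p ∈ S | p σ}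

/-- Positive combinations are monotone in the set of basis predicates that hold. -/
theorem PosComb.mono_of_TS_subset {St : Type*} {S : Set (St → Prop)} {p : St → Prop}
    (hp : PosComb S p) {σ τ : St} (hsub : TS S σ ⊆ TS S τ) : p σ → p τ := by
  induction hp with
  | base hmem => exact fun h => (hsub ⟨hmem, h⟩).2
  | and _ _ ihp ihq => exact And.imp ihp ihq
  | or _ _ ihp ihq => exact Or.imp ihp ihq

/-- If the successor basis `S'` is wp-closed over `S` along `f`, then inclusion of the
predicates holding at two states is preserved by the step `f`. -/
theorem TS_step_subset {St : Type*} {S S' : Set (St → Prop)} {f : St → St}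
    (hwp : ∀ φ ∈ S', PosComb S (fun σ => φ (f σ))) {σ τ : St}
    (hsub : TS S σ ⊆ TS S τ) : TS S' (f σ) ⊆ TS S' (f τ) :=
  fun φ hφ => ⟨hφ.1, (hwp φ hφ.1).mono_of_TS_subset hsub hφ.2⟩

/-- Observational equivalence of the interleaved and serialized executions: for `k`
threads (ordered by linearization points), each with a closed basis chain along its
path (guards and negations positively covered, wp-closedness), interference-free
interleaved views `τ`, shared quiescent bases between consecutive threads that no
thread disturbs across thread boundaries, and the serial execution `ρ` started from
`σ₀`, every guard holds along the serial execution (it is feasible), the serial states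
satisfy `TS (B h i) (ρ h i) ⊆ TS (B h i) (τ h i)`, and if each thread's return value
is covered by its final basis then every thread returns the same value in the
interleaved execution as in the serial execution. -/
theorem interleaved_serial_observational_equivalence
    {St : Type*} (k : ℕ) (n : ℕ → ℕ)
    (f : ℕ → ℕ → St → St) (g : ℕ → ℕ → St → Prop)
    (B : ℕ → ℕ → Set (St → Prop)) (τ ρ : ℕ → ℕ → St) (σ₀ : St)
    (α : ℕ → Type*) (ret : (h : ℕ) → St → α h)
    (hg : ∀ h < k, ∀ i < n h,
      PosComb (B h i) (g h i) ∧ PosComb (B h i) (fun σ => ¬ g h i σ))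
    (hwp : ∀ h < k, ∀ i < n h, ∀ φ ∈ B h (i + 1), PosComb (B h i) (fun σ => φ (f h i σ)))
    (hτ : ∀ h < k, ∀ i < n h, g h i (τ h i) ∧
      TS (B h (i + 1)) (f h i (τ h i)) ⊆ TS (B h (i + 1)) (τ h (i + 1)))
    (hquiB : ∀ h : ℕ, h + 1 < k → B h (n h) = B (h + 1) 0)
    (hquiτ : ∀ h : ℕ, h + 1 < k →
      TS (B (h + 1) 0) (τ h (n h)) ⊆ TS (B (h + 1) 0) (τ (h + 1) 0))
    (hσ₀ : TS (B 0 0) σ₀ ⊆ TS (B 0 0) (τ 0 0))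
    (hρ0 : ρ 0 0 = σ₀)
    (hρ : ∀ h < k, ∀ i < n h, ρ h (i + 1) = f h i (ρ h i))
    (hρqui : ∀ h : ℕ, h + 1 < k → ρ (h + 1) 0 = ρ h (n h))
    (hret : ∀ h < k, ∀ c : α h, PosComb (B h (n h)) (fun σ => ret h σ = c)) :
    (∀ h < k, ∀ i < n h, g h i (ρ h i)) ∧
    (∀ h < k, ∀ i ≤ n h, TS (B h i) (ρ h i) ⊆ TS (B h i) (τ h i)) ∧
    (∀ h < k, ret h (ρ h (n h)) = ret h (τ h (n h))) := by
  have along_thread : ∀ h < k, TS (B h 0) (ρ h 0) ⊆ TS (B h 0) (τ h 0) →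
      ∀ i ≤ n h, TS (B h i) (ρ h i) ⊆ TS (B h i) (τ h i) := by
    intro h hh h0 i
    induction i with
    | zero => exact fun _ => h0
    | succ i ih =>
      intro hi
      rw [hρ h hh i hi]
      exact (TS_step_subset (hwp h hh i hi) (ih (Nat.le_of_succ_le hi))).trans
        (hτ h hh i hi).2
  have at_start : ∀ h < k, TS (B h 0) (ρ h 0) ⊆ TS (B h 0) (τ h 0) := by
    intro h
    induction h with
    | zero => exact fun _ => hρ0 ▸ hσ₀
    | succ h ih =>
      intro hh
      have hend := along_thread h (Nat.lt_of_succ_lt hh) (ih (Nat.lt_of_succ_lt hh)) (n h) le_rfl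
      rw [hquiB h hh] at hend
      rw [hρqui h hh]
      exact hend.trans (hquiτ h hh)
  have hsub : ∀ h < k, ∀ i ≤ n h, TS (B h i) (ρ h i) ⊆ TS (B h i) (τ h i) :=
    fun h hh => along_thread h hh (at_start h hh)
  refine ⟨fun h hh i hi => ?_, hsub, fun h hh => ?_⟩
  · by_contra hng
    exact (hg h hh i hi).2.mono_of_TS_subset (hsub h hh i hi.le) hng (hτ h hh i hi).1
  · exact ((hret h hh _).mono_of_TS_subset (hsub h hh (n h) le_rfl) rfl).symm
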